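/- The action of G_n on minimal pairs is proper in the following sequential sense: let (A_k, u_k, v_k, c_k) be a sequence with A_k ∈ GL(n,ℝ), u_k, v_k ∈ ℝⁿ, c_k ∈ ℝ, and let (C_k, F_k) be a sequence of minimal pairs converging pointwise to a minimal pair (C*, F*). Suppose the transformed pairs (C_k + ⟨u_k, F_k⟩ + c_k, A_k∘F_k + v_k) converge pointwise to a minimal pair (G*, H*). Then there is a subsequence along which A_k converges in the space of n×n matrices to an invertible matrix, and u_k, v_k, c_k converge in ℝⁿ, ℝⁿ and ℝ respectively. -/

import Mathlib

open scoped BigOperators Topology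
open Filter

/-- `(C,F)` is minimal when `1, F₁, …, Fₙ` are linearly independent in `Ω → ℝ`. -/
def IsMinimal {Ω : Type*} {n : ℕ} (F : Ω → Fin n → ℝ) : Prop :=
  LinearIndependent ℝ
    (Fin.cons (fun _ => (1 : ℝ)) (fun i x => F x i) : Fin (n + 1) → Ω → ℝ)

/-- If matrices `B k` converge to a matrix with linearly independent rows and the products
`w k ᵥ* B k` converge, then the coefficient vectors `w k` converge. -/
theorem exists_tendsto_of_tendsto_vecMul {ι m Ω : Type*} [Fintype m] [Fintype Ω]
    {l : Filter ι} {B : ι → Matrix m Ω ℝ} {Bstar : Matrix m Ω ℝ} {w : ι → m → ℝ} {g : Ω → ℝ}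
    (hind : LinearIndependent ℝ Bstar.row) (hB : Tendsto B l (𝓝 Bstar))
    (hw : Tendsto (fun k => Matrix.vecMul (w k) (B k)) l (𝓝 g)) :
    ∃ wstar, Tendsto w l (𝓝 wstar) := by
  classical
  have hdet : (Bstar * Bstar.transpose).det ≠ 0 := by
    have h := Matrix.PosDef.mul_conjTranspose_self Bstar (Matrix.vecMul_injective_iff.2 hind)
    rw [Matrix.conjTranspose_eq_transpose_of_trivial] at h
    exact h.det_pos.ne'
  have hgram : Tendsto (fun k => B k * (B k).transpose) l (𝓝 (Bstar * Bstar.transpose)) :=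
    ((continuous_id.matrix_mul continuous_id.matrix_transpose).tendsto Bstar).comp hB
  have hunit : ∀ᶠ k in l, (B k * (B k).transpose).det ≠ 0 :=
    ((continuous_id.matrix_det.tendsto _).comp hgram).eventually_ne hdet
  have hinv : Tendsto (fun k => (B k * (B k).transpose)⁻¹) l
      (𝓝 (Bstar * Bstar.transpose)⁻¹) := by
    refine (continuousAt_matrix_inv _ ?_).tendsto.comp hgram
    rw [Ring.inverse_eq_inv']
    exact continuousAt_inv₀ hdet
  have hlim : Tendsto (fun k => Matrix.vecMul (Matrix.vecMul (Matrix.vecMul (w k) (B k))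
      (B k).transpose) (B k * (B k).transpose)⁻¹) l
      (𝓝 (Matrix.vecMul (Matrix.vecMul g Bstar.transpose) (Bstar * Bstar.transpose)⁻¹)) := by
    have hcont : Continuous fun p : (Ω → ℝ) × Matrix m Ω ℝ × Matrix m m ℝ =>
        Matrix.vecMul (Matrix.vecMul p.1 p.2.1.transpose) p.2.2 := by
      fun_prop
    have hprod := hw.prodMk_nhds (hB.prodMk_nhds hinv)
    have hcomp := (hcont.tendsto _).comp hprod
    exact hcomp
  refine ⟨_, hlim.congr' ?_⟩
  filter_upwards [hunit] with k hk
  rw [Matrix.vecMul_vecMul, Matrix.vecMul_vecMul, ← Matrix.mul_assoc,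
    Matrix.mul_nonsing_inv _ (isUnit_iff_ne_zero.2 hk), Matrix.vecMul_one]

/-- The matrix whose rows are the constant function `1` and the components of `F`. -/
def affineRows {Ω : Type*} {n : ℕ} (F : Ω → Fin n → ℝ) : Matrix (Fin (n + 1)) Ω ℝ :=
  Fin.cons (fun _ => (1 : ℝ)) (fun i x => F x i)

theorem cons_vecMul_affineRows {Ω : Type*} {n : ℕ} (F : Ω → Fin n → ℝ) (b : ℝ)
    (a : Fin n → ℝ) :
    Matrix.vecMul (Fin.cons b a : Fin (n + 1) → ℝ) (affineRows F) =
      fun x => (∑ i, a i * F x i) + b := by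
  ext x
  simp [Matrix.vecMul, dotProduct, affineRows, Fin.sum_univ_succ, add_comm]

theorem continuous_affineRows {Ω : Type*} {n : ℕ} :
    Continuous (affineRows : (Ω → Fin n → ℝ) → Matrix (Fin (n + 1)) Ω ℝ) := by
  refine continuous_matrix fun i x => ?_
  refine Fin.cases ?_ (fun j => ?_) i
  · exact continuous_const
  · exact (continuous_apply j).comp (continuous_apply x)

theorem exists_tendsto_affine_coefficients {ι Ω : Type*} [Fintype Ω] {n : ℕ} {l : Filter ι}
    {F : ι → Ω → Fin n → ℝ} {Fstar : Ω → Fin n → ℝ} {a : ι → Fin n → ℝ} {b : ι → ℝ}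
    {g : Ω → ℝ} (hmin : IsMinimal Fstar) (hF : Tendsto F l (𝓝 Fstar))
    (h : Tendsto (fun k x => (∑ i, a k i * F k x i) + b k) l (𝓝 g)) :
    ∃ astar bstar, Tendsto a l (𝓝 astar) ∧ Tendsto b l (𝓝 bstar) := by
  obtain ⟨w, hw⟩ := exists_tendsto_of_tendsto_vecMul
    (w := fun k => (Fin.cons (b k) (a k) : Fin (n + 1) → ℝ)) (Bstar := affineRows Fstar) hmin
    ((continuous_affineRows.tendsto Fstar).comp hF)
    (by simpa only [Function.comp_apply, cons_vecMul_affineRows] using h)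
  rw [tendsto_pi_nhds] at hw
  exact ⟨fun i => w i.succ, w 0, tendsto_pi_nhds.2 fun i => by simpa using hw i.succ,
    by simpa using hw 0⟩

theorem IsMinimal.isUnit_of_affine {Ω : Type*} {n : ℕ} {F H : Ω → Fin n → ℝ}
    {A : Matrix (Fin n) (Fin n) ℝ} {v : Fin n → ℝ} (hH : IsMinimal H)
    (h : ∀ x, H x = A.mulVec (F x) + v) : IsUnit A := by
  rw [← Matrix.vecMul_injective_iff_isUnit, ← Matrix.coe_vecMulLinear,
    injective_iff_map_eq_zero]
  intro y hy
  have hy' : Matrix.vecMul y A = 0 := hy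
  have hzero : Matrix.vecMul (Fin.cons (-(y ⬝ᵥ v)) y : Fin (n + 1) → ℝ) (affineRows H) = 0 := by
    rw [cons_vecMul_affineRows]
    ext x
    change y ⬝ᵥ H x + -(y ⬝ᵥ v) = 0
    rw [h x, dotProduct_add, Matrix.dotProduct_mulVec, hy', zero_dotProduct]
    ring
  have hinj : Function.Injective (affineRows H).vecMul := Matrix.vecMul_injective_iff.2 hH
  have hcons := hinj (hzero.trans (Matrix.zero_vecMul _).symm)
  ext i
  simpa using congrFun hcons i.succ

/-- Sequential properness of the `G_n`-action on minimal pairs: if `(C_k,F_k)` are minimal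
pairs converging (pointwise) to a minimal pair `(C*,F*)`, and the transformed pairs
`(A_k,u_k,v_k,c_k)·(C_k,F_k)` converge (pointwise) to a minimal pair `(G*,H*)`, then along
a subsequence `A_k` converges to an invertible matrix and `u_k`, `v_k`, `c_k` converge. -/
theorem Gn_action_proper {Ω : Type*} [Fintype Ω] [Nonempty Ω] {n : ℕ}
    (A : ℕ → Matrix (Fin n) (Fin n) ℝ) (u v : ℕ → Fin n → ℝ) (c : ℕ → ℝ)
    (hA : ∀ k, IsUnit (A k))
    (C : ℕ → Ω → ℝ) (F : ℕ → Ω → Fin n → ℝ)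
    (hmin : ∀ k, IsMinimal (F k))
    (Cstar : Ω → ℝ) (Fstar : Ω → Fin n → ℝ) (hminstar : IsMinimal Fstar)
    (hCconv : Tendsto C atTop (𝓝 Cstar))
    (hFconv : Tendsto F atTop (𝓝 Fstar))
    (Gstar : Ω → ℝ) (Hstar : Ω → Fin n → ℝ) (hminGH : IsMinimal Hstar)
    (hGconv : Tendsto (fun k => fun x : Ω => C k x + (∑ i, u k i * F k x i) + c k)
      atTop (𝓝 Gstar))
    (hHconv : Tendsto (fun k => fun (x : Ω) (i : Fin n) => (∑ j, A k i j * F k x j) + v k i)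
      atTop (𝓝 Hstar)) :
    ∃ φ : ℕ → ℕ, StrictMono φ ∧
      ∃ (Astar : Matrix (Fin n) (Fin n) ℝ) (ustar vstar : Fin n → ℝ) (cstar : ℝ),
        IsUnit Astar ∧
        Tendsto (fun k => A (φ k)) atTop (𝓝 Astar) ∧
        Tendsto (fun k => u (φ k)) atTop (𝓝 ustar) ∧
        Tendsto (fun k => v (φ k)) atTop (𝓝 vstar) ∧
        Tendsto (fun k => c (φ k)) atTop (𝓝 cstar) := by
  have hrow : ∀ i, ∃ astar bstar, Tendsto (fun k => A k i) atTop (𝓝 astar) ∧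
      Tendsto (fun k => v k i) atTop (𝓝 bstar) := fun i =>
    exists_tendsto_affine_coefficients (g := fun x => Hstar x i) hminstar hFconv <|
      tendsto_pi_nhds.2 fun x => tendsto_pi_nhds.1 (tendsto_pi_nhds.1 hHconv x) i
  choose Astar vstar hAlim hvlim using hrow
  have hGC : Tendsto (fun k x => (∑ i, u k i * F k x i) + c k) atTop (𝓝 (Gstar - Cstar)) := by
    refine (hGconv.sub hCconv).congr fun k => ?_
    ext x
    simp only [Pi.sub_apply]
    ring
  obtain ⟨ustar, cstar, hu, hc⟩ := exists_tendsto_affine_coefficients hminstar hFconv hGC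
  refine ⟨id, strictMono_id, Matrix.of Astar, ustar, vstar, cstar, ?_, tendsto_pi_nhds.2 hAlim,
    hu, tendsto_pi_nhds.2 hvlim, hc⟩
  refine hminGH.isUnit_of_affine (F := Fstar) (v := vstar) fun x => ?_
  ext i
  refine tendsto_nhds_unique (tendsto_pi_nhds.1 (tendsto_pi_nhds.1 hHconv x) i) ?_
  refine (tendsto_finsetSum _ fun j _ => ?_).add (hvlim i)
  exact (tendsto_pi_nhds.1 (hAlim i) j).mul (tendsto_pi_nhds.1 (tendsto_pi_nhds.1 hFconv x) j)
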